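/- arXiv:1902.08458 — 3 statements merged into one kernel-verified Lean document; each statement's English description precedes it below -/
import Mathlib

section
/- Let Ω ⊆ ℝ^n be a nonempty closed convex set, let P_Ω denote the metric projection onto Ω, fix y ∈ ℝ^n, and define V : ℝ^n → ℝ by V(x) = (1/2)(‖x − P_Ω(y)‖² − ‖x − P_Ω(x)‖²). Then V(x) ≥ (1/2)‖P_Ω(x) − P_Ω(y)‖² for all x ∈ ℝ^n. -/
open scoped RealInnerProductSpace

/-- With `V(x) = (1/2)(‖x − P_Ω(y)‖² − ‖x − P_Ω(x)‖²)` one has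
`V(x) ≥ (1/2)‖P_Ω(x) − P_Ω(y)‖²` for all `x`. -/
theorem lyapunov_fn_ge {n : ℕ}
    (Ω : Set (EuclideanSpace ℝ (Fin n)))
    (hne : Ω.Nonempty) (hcl : IsClosed Ω) (hconv : Convex ℝ Ω)
    (P : EuclideanSpace ℝ (Fin n) → EuclideanSpace ℝ (Fin n))
    (hP : ∀ u, P u ∈ Ω ∧ ∀ y ∈ Ω, ⟪u - P u, y - P u⟫ ≤ 0)
    (y : EuclideanSpace ℝ (Fin n))
    (V : EuclideanSpace ℝ (Fin n) → ℝ)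
    (hV : ∀ x, V x = (1 / 2) * (‖x - P y‖ ^ 2 - ‖x - P x‖ ^ 2)) :
    ∀ x, V x ≥ (1 / 2) * ‖P x - P y‖ ^ 2 := by
  intro x
  have hinner := (hP x).2 (P y) (hP y).1
  have hexpand := norm_sub_sq_real (x - P x) (P y - P x)
  rw [sub_sub_sub_cancel_right, norm_sub_rev (P y) (P x)] at hexpand
  rw [hV]
  linarith
end

section
/- Let Ω ⊆ ℝ^n be a nonempty closed convex set, let P_Ω denote the metric projection onto Ω, fix y ∈ ℝ^n, and define V : ℝ^n → ℝ by V(x) = (1/2)(‖x − P_Ω(y)‖² − ‖x − P_Ω(x)‖²). Then V is convex on ℝ^n and differentiable at every x ∈ ℝ^n with gradient ∇V(x) = P_Ω(x) − P_Ω(y). -/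
open scoped RealInnerProductSpace

section

variable {E : Type*} [NormedAddCommGroup E] [InnerProductSpace ℝ E]

/-- A function that has a subgradient at every point is convex. -/
theorem convexOn_univ_of_forall_inner_le_sub {f : E → ℝ} {g : E → E}
    (h : ∀ x z, ⟪g x, z - x⟫ ≤ f z - f x) : ConvexOn ℝ Set.univ f := by
  refine ⟨convex_univ, fun x _ z _ a b ha hb hab => ?_⟩
  set w := a • x + b • z with hw
  have hx := mul_le_mul_of_nonneg_left (h w x) ha
  have hz := mul_le_mul_of_nonneg_left (h w z) hb
  have hsum : a * ⟪g w, x - w⟫ + b * ⟪g w, z - w⟫ = 0 := by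
    rw [← real_inner_smul_right, ← real_inner_smul_right, ← inner_add_right]
    have : a • (x - w) + b • (z - w) = 0 := by
      rw [smul_sub, smul_sub, sub_add_sub_comm, ← hw, ← add_smul, hab, one_smul, sub_self]
    rw [this, inner_zero_right]
  have hfw : a * f w + b * f w = f w := by rw [← add_mul, hab, one_mul]
  simp only [smul_eq_mul]
  linarith

/-- A function whose first-order remainder is bounded by a multiple of the squared distance has
the corresponding gradient. -/
theorem hasGradientAt_of_abs_sub_le_norm_sq [CompleteSpace E] {f : E → ℝ} {x v : E} {C : ℝ}
    (h : ∀ z, |f z - f x - ⟪v, z - x⟫| ≤ C * ‖z - x‖ ^ 2) : HasGradientAt f v x := by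
  rw [hasGradientAt_iff_isLittleO]
  have hO : (fun z => f z - f x - ⟪v, z - x⟫) =O[nhds x] fun z => ‖z - x‖ ^ 2 :=
    .of_bound C (.of_forall fun z => by simpa using h z)
  exact hO.trans_isLittleO (Asymptotics.isLittleO_pow_sub_sub x one_lt_two)

/-- First-order bounds for `x ↦ (‖x - q‖ ^ 2 - ‖x - p‖ ^ 2) / 2`, where `p` and `r` are the
projections of `x` and `z`. -/
theorem first_order_bounds_of_inner_le_zero {x z p r : E} (q : E)
    (hp : ⟪x - p, r - p⟫ ≤ 0) (hr : ⟪z - r, p - r⟫ ≤ 0) :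
    0 ≤ (1 / 2) * (‖z - q‖ ^ 2 - ‖z - r‖ ^ 2) - (1 / 2) * (‖x - q‖ ^ 2 - ‖x - p‖ ^ 2)
        - ⟪p - q, z - x⟫ ∧
      (1 / 2) * (‖z - q‖ ^ 2 - ‖z - r‖ ^ 2) - (1 / 2) * (‖x - q‖ ^ 2 - ‖x - p‖ ^ 2)
        - ⟪p - q, z - x⟫ ≤ (1 / 2) * ‖z - x‖ ^ 2 := by
  have hrp : 0 ≤ ‖r - p‖ ^ 2 := sq_nonneg _
  have hd : 0 ≤ ‖(z - x) - (r - p)‖ ^ 2 := sq_nonneg _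
  simp only [← real_inner_self_eq_norm_sq, inner_sub_left, inner_sub_right] at *
  rw [real_inner_comm z x, real_inner_comm p x, real_inner_comm r x, real_inner_comm q x,
    real_inner_comm p z, real_inner_comm r z, real_inner_comm q z, real_inner_comm r p] at *
  constructor <;> linarith

end

/-- With `V(x) = (1/2)(‖x − P_Ω(y)‖² − ‖x − P_Ω(x)‖²)`, the function `V` is
convex on `ℝ^n` and differentiable everywhere with gradient `∇V(x) = P_Ω(x) − P_Ω(y)`. -/
theorem lyapunov_fn_convex_gradient {n : ℕ}
    (Ω : Set (EuclideanSpace ℝ (Fin n)))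
    (hne : Ω.Nonempty) (hcl : IsClosed Ω) (hconv : Convex ℝ Ω)
    (P : EuclideanSpace ℝ (Fin n) → EuclideanSpace ℝ (Fin n))
    (hP : ∀ u, P u ∈ Ω ∧ ∀ y ∈ Ω, ⟪u - P u, y - P u⟫ ≤ 0)
    (y : EuclideanSpace ℝ (Fin n))
    (V : EuclideanSpace ℝ (Fin n) → ℝ)
    (hV : ∀ x, V x = (1 / 2) * (‖x - P y‖ ^ 2 - ‖x - P x‖ ^ 2)) :
    ConvexOn ℝ Set.univ V ∧ ∀ x, HasGradientAt V (P x - P y) x := by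
  have hbounds := fun x z =>
    first_order_bounds_of_inner_le_zero (P y) ((hP x).2 _ (hP z).1) ((hP z).2 _ (hP x).1)
  simp only [← hV] at hbounds
  exact ⟨convexOn_univ_of_forall_inner_le_sub fun x z => sub_nonneg.1 (hbounds x z).1,
    fun x => hasGradientAt_of_abs_sub_le_norm_sq fun z => by
      rw [abs_of_nonneg (hbounds x z).1]
      exact (hbounds x z).2⟩
end

section
/- With the notation of the algorithm state, let φ = (x̄, Z̄, W̄, U, Λ̄¹, Λ̄², Y¹, Y²) be arbitrary, set x = P_Ω(x̄), Z = P_{ℝ₊^{mnq}}(Z̄), W = P_{ℝ₊^{mnq}}(W̄), Λ¹ = P_{ℝ₊^{mnq}}(Λ̄¹), Λ² = P_{ℝ₊^{mnq}}(Λ̄²), and let g ∈ ∂f(x). Let φ* = (x̄*, Z̄*, W̄*, U*, Λ̄¹*, Λ̄²*, Y¹*, Y²*) be an equilibrium of the dynamics with projected variables x*, Z*, W*, Λ¹*, Λ²* and associated subgradient g* ∈ ∂f(x*), i.e., x̄* = x* − g* − E A* Λ¹* − E Â* Λ²*, Z̄* = Z* − (1/n)Γ Λ¹* + Λ²* − L_{mnq}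 U*, W̄* = W* − Λ¹* + Λ²*, L_{mnq} Z* = 0, Λ̄¹* = Λ¹* + (A* Eᵀ x* + (1/n)Γ Z* + W* − B) + L_{mnq} Y¹*, Λ̄²* = Λ²* + (Â* Eᵀ x* − Z* − W*) + L_{mnq} Y²*, L_{mnq} Λ¹* = 0, L_{mnq} Λ²* = 0. Define β = ⟪x − x*, −x̄ + x − g − E A* Λ¹ − E Â* Λ²⟫ + ⟪Z − Z*, −Z̄ + Z − (1/n)Γ Λ¹ + Λ² − L_{mnq} U⟫ + ⟪W − W*, −W̄ + W − Λ¹ + Λ²⟫ + ⟪U − U*, L_{mnq} Z⟫ + ⟪Λ¹ − Λ¹*, −Λ̄¹ + Λ¹ + (A* Eᵀ x + (1/n)Γ Z + W − B) + L_{mnq} Y¹ − L_{mnq} Λ¹⟫ + ⟪Λ² − Λ²*, −Λ̄² + Λ² + (Â* Eᵀ x − Z − W) + L_{mnq} Y² − L_{mnq} Λ²⟫ − ⟪Y¹ − Y¹*, L_{mnq} Λ¹⟫ − ⟪Y² − Y²*, L_{mnq} Λ²⟫. Then β ≤ −⟪x − x*, g − g*⟫ − (Λ¹)ᵀ L_{mnq}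 Λ¹ − (Λ²)ᵀ L_{mnq} Λ² ≤ 0. -/
open Finset

/-- The weighted graph Laplacian acting on the first index of a three-index array. -/
def blockLap {n m q : ℕ} (α : Fin n → Fin n → ℝ) (V : Fin n → Fin m → Fin q → ℝ) :
    Fin n → Fin m → Fin q → ℝ :=
  fun i j l => ∑ k, α i k * (V i j l - V k j l)

/-- The Euclidean pairing of two three-index arrays. -/
def blockInner {n m q : ℕ} (V W : Fin n → Fin m → Fin q → ℝ) : ℝ :=
  ∑ i, ∑ j, ∑ l, V i j l * W i j l

theorem blockInner_eq_sum_fiber {n m q : ℕ} (V W : Fin n → Fin m → Fin q → ℝ) :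
    blockInner V W = ∑ j, ∑ l, ∑ i, V i j l * W i j l := by
  unfold blockInner
  rw [sum_comm]
  exact sum_congr rfl fun j _ => sum_comm

theorem blockInner_sub_left {n m q : ℕ} (V V' W : Fin n → Fin m → Fin q → ℝ) :
    blockInner (V - V') W = blockInner V W - blockInner V' W := by
  simp only [blockInner, Pi.sub_apply, sub_mul, sum_sub_distrib]

theorem blockLap_sub {n m q : ℕ} (α : Fin n → Fin n → ℝ) (V W : Fin n → Fin m → Fin q → ℝ) :
    blockLap α (V - W) = blockLap α V - blockLap α W := by
  funext i j l
  simp only [blockLap, Pi.sub_apply, ← sum_sub_distrib]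
  exact sum_congr rfl fun k _ => by ring

/-- Twice the Dirichlet form of a symmetric weight, written as a sum over edges. -/
theorem two_mul_sum_mul_lap {n : ℕ} {α : Fin n → Fin n → ℝ} (hα : ∀ i k, α i k = α k i)
    (v w : Fin n → ℝ) :
    2 * ∑ i, v i * ∑ k, α i k * (w i - w k)
      = ∑ i, ∑ k, α i k * ((v i - v k) * (w i - w k)) := by
  have h : ∑ i, v i * ∑ k, α i k * (w i - w k)
      = ∑ i, ∑ k, v k * (α i k * (w k - w i)) := by
    rw [sum_comm]
    simp only [mul_sum]
    exact sum_congr rfl fun i _ => sum_congr rfl fun k _ => by rw [hα i k]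
  rw [two_mul]
  nth_rewrite 2 [h]
  simp only [mul_sum, ← sum_add_distrib]
  exact sum_congr rfl fun i _ => sum_congr rfl fun k _ => by ring

theorem blockInner_blockLap_comm {n m q : ℕ} {α : Fin n → Fin n → ℝ}
    (hα : ∀ i k, α i k = α k i) (V W : Fin n → Fin m → Fin q → ℝ) :
    blockInner V (blockLap α W) = blockInner W (blockLap α V) := by
  rw [blockInner_eq_sum_fiber, blockInner_eq_sum_fiber]
  refine sum_congr rfl fun j _ => sum_congr rfl fun l _ => ?_
  have h₁ := two_mul_sum_mul_lap hα (fun i => V i j l) (fun i => W i j l)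
  have h₂ := two_mul_sum_mul_lap hα (fun i => W i j l) (fun i => V i j l)
  simp only [mul_comm (W _ j l - W _ j l)] at h₂
  simp only [blockLap]
  linarith

theorem blockInner_blockLap_self_nonneg {n m q : ℕ} {α : Fin n → Fin n → ℝ}
    (hα : ∀ i k, α i k = α k i) (hα₀ : ∀ i k, 0 ≤ α i k) (V : Fin n → Fin m → Fin q → ℝ) :
    0 ≤ blockInner V (blockLap α V) := by
  rw [blockInner_eq_sum_fiber]
  refine sum_nonneg fun j _ => sum_nonneg fun l _ => ?_
  have h := two_mul_sum_mul_lap hα (fun i => V i j l) (fun i => V i j l)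
  have h₀ : 0 ≤ ∑ i, ∑ k, α i k * ((V i j l - V k j l) * (V i j l - V k j l)) :=
    sum_nonneg fun i _ => sum_nonneg fun k _ => mul_nonneg (hα₀ i k) (mul_self_nonneg _)
  simp only [blockLap]
  linarith

/-- Firm nonexpansiveness of the projection onto the nonnegative half-line. -/
theorem max_zero_sub_mul_nonpos (s t : ℝ) :
    (max s 0 - max t 0) * ((max s 0 - s) - (max t 0 - t)) ≤ 0 := by
  rcases le_total s 0 with hs | hs <;> rcases le_total t 0 with ht | ht <;>
    simp only [max_eq_left, max_eq_right, hs, ht] <;> nlinarith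

theorem blockInner_posPart_nonpos {n m q : ℕ} {V Vbar W Wbar : Fin n → Fin m → Fin q → ℝ}
    (hV : ∀ i j l, V i j l = max (Vbar i j l) 0) (hW : ∀ i j l, W i j l = max (Wbar i j l) 0) :
    blockInner (V - W) ((V - Vbar) - (W - Wbar)) ≤ 0 := by
  refine sum_nonpos fun i _ => sum_nonpos fun j _ => sum_nonpos fun l _ => ?_
  simp only [Pi.sub_apply, hV, hW]
  exact max_zero_sub_mul_nonpos _ _

/-- Firm nonexpansiveness of the projection onto a set, from its variational inequality. -/
theorem sum_proj_sub_mul_nonpos {q : ℕ} {C : Set (Fin q → ℝ)} {x xbar y ybar : Fin q → ℝ}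
    (hx : x ∈ C ∧ ∀ z ∈ C, ∑ l, (xbar l - x l) * (z l - x l) ≤ 0)
    (hy : y ∈ C ∧ ∀ z ∈ C, ∑ l, (ybar l - y l) * (z l - y l) ≤ 0) :
    ∑ l, (x l - y l) * ((x l - xbar l) - (y l - ybar l)) ≤ 0 := by
  have h := add_nonpos (hx.2 y hy.1) (hy.2 x hx.1)
  rw [← sum_add_distrib] at h
  refine le_of_eq_of_le (sum_congr rfl fun l _ => ?_) h
  ring

/-- Monotonicity of the subdifferential. -/
theorem sum_subgradient_sub_nonneg {n q : ℕ} {f : Fin n → (Fin q → ℝ) → ℝ}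
    {x y g h : Fin n → Fin q → ℝ}
    (hg : ∀ z : Fin n → Fin q → ℝ,
      (∑ i, f i (x i)) + (∑ i, ∑ l, g i l * (z i l - x i l)) ≤ ∑ i, f i (z i))
    (hh : ∀ z : Fin n → Fin q → ℝ,
      (∑ i, f i (y i)) + (∑ i, ∑ l, h i l * (z i l - y i l)) ≤ ∑ i, f i (z i)) :
    0 ≤ ∑ i, ∑ l, (x i l - y i l) * (g i l - h i l) := by
  have h₁ := hg y
  have h₂ := hh x
  have e : ∑ i, ∑ l, (x i l - y i l) * (g i l - h i l)
      = -(∑ i, ∑ l, g i l * (y i l - x i l)) - ∑ i, ∑ l, h i l * (x i l - y i l) := by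
    simp only [← sum_neg_distrib, ← sum_sub_distrib]
    exact sum_congr rfl fun i _ => sum_congr rfl fun l _ => by ring
  linarith

/-- Moving the stacking operator `E` across the inner product. -/
theorem sum_mul_sum_eq_blockInner {n m q : ℕ} (u : Fin n → Fin q → ℝ)
    (a V : Fin n → Fin m → Fin q → ℝ) :
    ∑ i, ∑ l, u i l * ∑ j, a i j l * V i j l = blockInner V fun i j l => a i j l * u i l := by
  refine sum_congr rfl fun i _ => ?_
  simp only [mul_sum]
  rw [sum_comm]
  exact sum_congr rfl fun j _ => sum_congr rfl fun l _ => by ring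

/-- Along the primal–dual projected dynamics, the Lie-derivative quantity `β`
of the Lyapunov function at an arbitrary state, relative to an equilibrium `φ*`, satisfies
`β ≤ −⟪x − x*, g − g*⟫ − (Λ¹)ᵀ L Λ¹ − (Λ²)ᵀ L Λ² ≤ 0`.
All vectors are written componentwise; `L` is the graph Laplacian acting blockwise, so
`(L V)_{ijl} = ∑_k α_{ik}(V_{ijl} − V_{kjl})`. -/
theorem lie_derivative_nonpos {n m q : ℕ} (hn : 0 < n)
    (f : Fin n → (Fin q → ℝ) → ℝ) (Ω : Fin n → Set (Fin q → ℝ))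
    (hΩ : ∀ i, (Ω i).Nonempty ∧ IsClosed (Ω i) ∧ Convex ℝ (Ω i))
    (hf : ∀ i, ∃ U : Set (Fin q → ℝ), IsOpen U ∧ Ω i ⊆ U ∧ ConvexOn ℝ U (f i))
    (a ahat B : Fin n → Fin m → Fin q → ℝ)
    (γ : Fin m → ℝ) (hγ : ∀ j, 0 < γ j)
    (α : Fin n → Fin n → ℝ)
    (hαsym : ∀ i k, α i k = α k i) (hαnn : ∀ i k, 0 ≤ α i k) (hαdiag : ∀ i, α i i = 0)
    (hconn : ∀ i k : Fin n, Relation.ReflTransGen (fun p r => 0 < α p r) i k)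
    -- arbitrary current state φ and its projected variables
    (xbar x : Fin n → Fin q → ℝ)
    (Zbar Wbar U L1bar L2bar Y1 Y2 Z W L1 L2 : Fin n → Fin m → Fin q → ℝ)
    (hx : ∀ i, x i ∈ Ω i ∧ ∀ y ∈ Ω i, ∑ l, (xbar i l - x i l) * (y l - x i l) ≤ 0)
    (hZ : ∀ i j l, Z i j l = max (Zbar i j l) 0)
    (hW : ∀ i j l, W i j l = max (Wbar i j l) 0)
    (hL1 : ∀ i j l, L1 i j l = max (L1bar i j l) 0)
    (hL2 : ∀ i j l, L2 i j l = max (L2bar i j l) 0)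
    (g : Fin n → Fin q → ℝ)
    (hg : ∀ y : Fin n → Fin q → ℝ,
      (∑ i, f i (x i)) + (∑ i, ∑ l, g i l * (y i l - x i l)) ≤ ∑ i, f i (y i))
    -- equilibrium state φ* and its projected variables
    (xbars xs : Fin n → Fin q → ℝ)
    (Zbars Wbars Us L1bars L2bars Y1s Y2s Zs Ws L1s L2s : Fin n → Fin m → Fin q → ℝ)
    (hxs : ∀ i, xs i ∈ Ω i ∧ ∀ y ∈ Ω i, ∑ l, (xbars i l - xs i l) * (y l - xs i l) ≤ 0)
    (hZs : ∀ i j l, Zs i j l = max (Zbars i j l) 0)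
    (hWs : ∀ i j l, Ws i j l = max (Wbars i j l) 0)
    (hL1s : ∀ i j l, L1s i j l = max (L1bars i j l) 0)
    (hL2s : ∀ i j l, L2s i j l = max (L2bars i j l) 0)
    (gs : Fin n → Fin q → ℝ)
    (hgs : ∀ y : Fin n → Fin q → ℝ,
      (∑ i, f i (xs i)) + (∑ i, ∑ l, gs i l * (y i l - xs i l)) ≤ ∑ i, f i (y i))
    -- the equilibrium equations for φ*
    (heq1 : ∀ i l, xbars i l
        = xs i l - gs i l - (∑ j, a i j l * L1s i j l) - ∑ j, ahat i j l * L2s i j l)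
    (heq2 : ∀ i j l, Zbars i j l
        = Zs i j l - (1 / (n : ℝ)) * γ j * L1s i j l + L2s i j l
          - ∑ k, α i k * (Us i j l - Us k j l))
    (heq3 : ∀ i j l, Wbars i j l = Ws i j l - L1s i j l + L2s i j l)
    (heq4 : ∀ i j l, ∑ k, α i k * (Zs i j l - Zs k j l) = 0)
    (heq5 : ∀ i j l, L1bars i j l
        = L1s i j l + (a i j l * xs i l + (1 / (n : ℝ)) * γ j * Zs i j l + Ws i j l - B i j l)
          + ∑ k, α i k * (Y1s i j l - Y1s k j l))
    (heq6 : ∀ i j l, L2bars i j l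
        = L2s i j l + (ahat i j l * xs i l - Zs i j l - Ws i j l)
          + ∑ k, α i k * (Y2s i j l - Y2s k j l))
    (heq7 : ∀ i j l, ∑ k, α i k * (L1s i j l - L1s k j l) = 0)
    (heq8 : ∀ i j l, ∑ k, α i k * (L2s i j l - L2s k j l) = 0)
    -- the Lie-derivative quantity β
    (β : ℝ)
    (hβ : β =
      (∑ i, ∑ l, (x i l - xs i l) *
        (-xbar i l + x i l - g i l - (∑ j, a i j l * L1 i j l)
          - ∑ j, ahat i j l * L2 i j l)) +
      (∑ i, ∑ j, ∑ l, (Z i j l - Zs i j l) *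
        (-Zbar i j l + Z i j l - (1 / (n : ℝ)) * γ j * L1 i j l + L2 i j l
          - ∑ k, α i k * (U i j l - U k j l))) +
      (∑ i, ∑ j, ∑ l, (W i j l - Ws i j l) *
        (-Wbar i j l + W i j l - L1 i j l + L2 i j l)) +
      (∑ i, ∑ j, ∑ l, (U i j l - Us i j l) * (∑ k, α i k * (Z i j l - Z k j l))) +
      (∑ i, ∑ j, ∑ l, (L1 i j l - L1s i j l) *
        (-L1bar i j l + L1 i j l
          + (a i j l * x i l + (1 / (n : ℝ)) * γ j * Z i j l + W i j l - B i j l)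
          + (∑ k, α i k * (Y1 i j l - Y1 k j l))
          - ∑ k, α i k * (L1 i j l - L1 k j l))) +
      (∑ i, ∑ j, ∑ l, (L2 i j l - L2s i j l) *
        (-L2bar i j l + L2 i j l
          + (ahat i j l * x i l - Z i j l - W i j l)
          + (∑ k, α i k * (Y2 i j l - Y2 k j l))
          - ∑ k, α i k * (L2 i j l - L2 k j l))) -
      (∑ i, ∑ j, ∑ l, (Y1 i j l - Y1s i j l) * (∑ k, α i k * (L1 i j l - L1 k j l))) -
      (∑ i, ∑ j, ∑ l, (Y2 i j l - Y2s i j l) * (∑ k, α i k * (L2 i j l - L2 k j l)))) :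
    β ≤ -(∑ i, ∑ l, (x i l - xs i l) * (g i l - gs i l))
        - (∑ i, ∑ j, ∑ l, L1 i j l * (∑ k, α i k * (L1 i j l - L1 k j l)))
        - (∑ i, ∑ j, ∑ l, L2 i j l * (∑ k, α i k * (L2 i j l - L2 k j l))) ∧
      -(∑ i, ∑ l, (x i l - xs i l) * (g i l - gs i l))
        - (∑ i, ∑ j, ∑ l, L1 i j l * (∑ k, α i k * (L1 i j l - L1 k j l)))
        - (∑ i, ∑ j, ∑ l, L2 i j l * (∑ k, α i k * (L2 i j l - L2 k j l))) ≤ 0 := by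
  have hmono := sum_subgradient_sub_nonneg hg hgs
  have hpos₁ := blockInner_blockLap_self_nonneg hαsym hαnn L1
  have hpos₂ := blockInner_blockLap_self_nonneg hαsym hαnn L2
  change β ≤ _ - blockInner L1 (blockLap α L1) - blockInner L2 (blockLap α L2) ∧
    _ - blockInner L1 (blockLap α L1) - blockInner L2 (blockLap α L2) ≤ 0
  refine ⟨?_, by linarith⟩
  have hPx : ∑ i, ∑ l, (x i l - xs i l) * ((x i l - xbar i l) - (xs i l - xbars i l)) ≤ 0 :=
    sum_nonpos fun i _ => sum_proj_sub_mul_nonpos (hx i) (hxs i)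
  have hPZ := blockInner_posPart_nonpos hZ hZs
  have hPW := blockInner_posPart_nonpos hW hWs
  have hPL1 := blockInner_posPart_nonpos hL1 hL1s
  have hPL2 := blockInner_posPart_nonpos hL2 hL2s
  have hZs₀ : blockLap α Zs = 0 := by funext i j l; exact heq4 i j l
  have hL1s₀ : blockLap α L1s = 0 := by funext i j l; exact heq7 i j l
  have hL2s₀ : blockLap α L2s = 0 := by funext i j l; exact heq8 i j l
  have hZU := blockInner_blockLap_comm hαsym (Z - Zs) (U - Us)
  have hLY1 := blockInner_blockLap_comm hαsym (L1 - L1s) (Y1 - Y1s)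
  have hLY2 := blockInner_blockLap_comm hαsym (L2 - L2s) (Y2 - Y2s)
  rw [blockLap_sub α Z, hZs₀, sub_zero] at hZU
  rw [blockLap_sub α L1, hL1s₀, sub_zero] at hLY1
  rw [blockLap_sub α L2, hL2s₀, sub_zero] at hLY2
  have hzero (V : Fin n → Fin m → Fin q → ℝ) : blockInner V 0 = 0 := by simp [blockInner]
  have hL1₀ : blockInner (L1 - L1s) (blockLap α L1) = blockInner L1 (blockLap α L1) := by
    rw [blockInner_sub_left, blockInner_blockLap_comm hαsym L1s, hL1s₀, hzero, sub_zero]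
  have hL2₀ : blockInner (L2 - L2s) (blockLap α L2) = blockInner L2 (blockLap α L2) := by
    rw [blockInner_sub_left, blockInner_blockLap_comm hαsym L2s, hL2s₀, hzero, sub_zero]
  have hbx : (∑ i, ∑ l, (x i l - xs i l) *
        (-xbar i l + x i l - g i l - (∑ j, a i j l * L1 i j l) - ∑ j, ahat i j l * L2 i j l))
      = (∑ i, ∑ l, (x i l - xs i l) * ((x i l - xbar i l) - (xs i l - xbars i l)))
        - (∑ i, ∑ l, (x i l - xs i l) * (g i l - gs i l))
        - blockInner (L1 - L1s) (fun i j l => a i j l * (x i l - xs i l))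
        - blockInner (L2 - L2s) (fun i j l => ahat i j l * (x i l - xs i l)) := by
    have e₁ := sum_mul_sum_eq_blockInner (fun i l => x i l - xs i l) a (L1 - L1s)
    have e₂ := sum_mul_sum_eq_blockInner (fun i l => x i l - xs i l) ahat (L2 - L2s)
    rw [← e₁, ← e₂]
    simp only [← sum_sub_distrib, Pi.sub_apply, mul_sub (a _ _ _), mul_sub (ahat _ _ _)]
    refine sum_congr rfl fun i _ => sum_congr rfl fun l _ => ?_
    rw [heq1, sum_sub_distrib, sum_sub_distrib]
    ring
  have hbZ : (∑ i, ∑ j, ∑ l, (Z i j l - Zs i j l) *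
        (-Zbar i j l + Z i j l - (1 / (n : ℝ)) * γ j * L1 i j l + L2 i j l
          - ∑ k, α i k * (U i j l - U k j l)))
      = blockInner (Z - Zs) ((Z - Zbar) - (Zs - Zbars))
        - blockInner (L1 - L1s) (fun i j l => (1 / (n : ℝ)) * γ j * (Z i j l - Zs i j l))
        + blockInner (L2 - L2s) (Z - Zs)
        - blockInner (Z - Zs) (blockLap α (U - Us)) := by
    rw [blockLap_sub]
    simp only [blockInner, ← sum_sub_distrib, ← sum_add_distrib, Pi.sub_apply, heq2]
    refine sum_congr rfl fun i _ => sum_congr rfl fun j _ => sum_congr rfl fun l _ => ?_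
    simp only [blockLap]
    ring
  have hbW : (∑ i, ∑ j, ∑ l, (W i j l - Ws i j l) *
        (-Wbar i j l + W i j l - L1 i j l + L2 i j l))
      = blockInner (W - Ws) ((W - Wbar) - (Ws - Wbars))
        - blockInner (L1 - L1s) (W - Ws) + blockInner (L2 - L2s) (W - Ws) := by
    simp only [blockInner, ← sum_sub_distrib, ← sum_add_distrib, Pi.sub_apply, heq3]
    refine sum_congr rfl fun i _ => sum_congr rfl fun j _ => sum_congr rfl fun l _ => ?_
    ring
  have hbL1 : (∑ i, ∑ j, ∑ l, (L1 i j l - L1s i j l) *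
        (-L1bar i j l + L1 i j l
          + (a i j l * x i l + (1 / (n : ℝ)) * γ j * Z i j l + W i j l - B i j l)
          + (∑ k, α i k * (Y1 i j l - Y1 k j l))
          - ∑ k, α i k * (L1 i j l - L1 k j l)))
      = blockInner (L1 - L1s) ((L1 - L1bar) - (L1s - L1bars))
        + blockInner (L1 - L1s) (fun i j l => a i j l * (x i l - xs i l))
        + blockInner (L1 - L1s) (fun i j l => (1 / (n : ℝ)) * γ j * (Z i j l - Zs i j l))
        + blockInner (L1 - L1s) (W - Ws)
        + blockInner (L1 - L1s) (blockLap α (Y1 - Y1s))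
        - blockInner (L1 - L1s) (blockLap α L1) := by
    rw [blockLap_sub]
    simp only [blockInner, ← sum_sub_distrib, ← sum_add_distrib, Pi.sub_apply, heq5]
    refine sum_congr rfl fun i _ => sum_congr rfl fun j _ => sum_congr rfl fun l _ => ?_
    simp only [blockLap]
    ring
  have hbL2 : (∑ i, ∑ j, ∑ l, (L2 i j l - L2s i j l) *
        (-L2bar i j l + L2 i j l
          + (ahat i j l * x i l - Z i j l - W i j l)
          + (∑ k, α i k * (Y2 i j l - Y2 k j l))
          - ∑ k, α i k * (L2 i j l - L2 k j l)))
      = blockInner (L2 - L2s) ((L2 - L2bar) - (L2s - L2bars))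
        + blockInner (L2 - L2s) (fun i j l => ahat i j l * (x i l - xs i l))
        - blockInner (L2 - L2s) (Z - Zs)
        - blockInner (L2 - L2s) (W - Ws)
        + blockInner (L2 - L2s) (blockLap α (Y2 - Y2s))
        - blockInner (L2 - L2s) (blockLap α L2) := by
    rw [blockLap_sub]
    simp only [blockInner, ← sum_sub_distrib, ← sum_add_distrib, Pi.sub_apply, heq6]
    refine sum_congr rfl fun i _ => sum_congr rfl fun j _ => sum_congr rfl fun l _ => ?_
    simp only [blockLap]
    ring
  have hbU : (∑ i, ∑ j, ∑ l, (U i j l - Us i j l) * (∑ k, α i k * (Z i j l - Z k j l)))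
      = blockInner (U - Us) (blockLap α Z) := rfl
  have hbY1 : (∑ i, ∑ j, ∑ l, (Y1 i j l - Y1s i j l) * (∑ k, α i k * (L1 i j l - L1 k j l)))
      = blockInner (Y1 - Y1s) (blockLap α L1) := rfl
  have hbY2 : (∑ i, ∑ j, ∑ l, (Y2 i j l - Y2s i j l) * (∑ k, α i k * (L2 i j l - L2 k j l)))
      = blockInner (Y2 - Y2s) (blockLap α L2) := rfl
  rw [hbx, hbZ, hbW, hbU, hbL1, hbL2, hbY1, hbY2] at hβ
  linarith
end
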